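/- Suppose S_λ ∈ B(ℓ²(β)) and φ̂ : ℕ₀ → ℂ is such that φ(z) = ∑_{k≥0} φ̂(k) z^k converges for all |z| < ‖S_λ‖ and φ is bounded on this disc. Then φ̂ ∈ M(T_β, λ) and ‖M_φ̂‖ ≤ sup{|φ(z)| : |z| < ‖S_λ‖}. -/

import Mathlib

open scoped ENNReal
open Filter

noncomputable section

/-- Membership in the weighted ℓ² space ℓ²(β). -/
def MemL2 {V : Type*} (β : V → ℝ) (f : V → ℂ) : Prop :=
  Summable fun v => β v * ‖f v‖ ^ 2

/-- The squared norm in ℓ²(β). -/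
noncomputable def wnormSq {V : Type*} (β : V → ℝ) (f : V → ℂ) : ℝ :=
  ∑' v, β v * ‖f v‖ ^ 2

/-- The inner product of ℓ²(β). -/
noncomputable def winner {V : Type*} (β : V → ℝ) (f g : V → ℂ) : ℂ :=
  ∑' v, f v * (starRingEnd ℂ) (g v) * (β v : ℂ)

/-- The indicator (basis) vector e_u. -/
def eVec {V : Type*} [DecidableEq V] (u : V) : V → ℂ :=
  fun v => if v = u then 1 else 0

/-- The formal weighted-shift map Λ with complex weights. -/
def shiftMap {V : Type*} [DecidableEq V] (root : V) (par : V → V) (lam : V → ℂ)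
    (f : V → ℂ) : V → ℂ :=
  fun v => if v = root then 0 else lam v * f (par v)

/-- The formal weighted-shift map Λ with positive real weights. -/
def shiftMapR {V : Type*} [DecidableEq V] (root : V) (par : V → V) (lam : V → ℝ)
    (f : V → ℂ) : V → ℂ :=
  fun v => if v = root then 0 else (lam v : ℂ) * f (par v)

/-- λ_{par^k(v)|v} : the product of the weights along the path from par^k(v) to v. -/
noncomputable def lamProd {V : Type*} (par : V → V) (lam : V → ℝ) (k : ℕ) (v : V) : ℝ :=
  ∏ j ∈ Finset.range k, lam (par^[j] v)

/-- The formal multiplication map Γ_φ̂. -/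
noncomputable def gammaMap {V : Type*} (par : V → V) (depth : V → ℕ) (lam : V → ℝ)
    (φ : ℕ → ℂ) (f : V → ℂ) : V → ℂ :=
  fun v => ∑ k ∈ Finset.range (depth v + 1),
    ((lamProd par lam k v : ℝ) : ℂ) * φ k * f (par^[k] v)

/-- φ̂ is a multiplier: the multiplication operator M_φ̂ is everywhere defined on ℓ²(β). -/
def Mult {V : Type*} (par : V → V) (depth : V → ℕ) (β lam : V → ℝ) (φ : ℕ → ℂ) : Prop :=
  ∀ f : V → ℂ, MemL2 β f → MemL2 β (gammaMap par depth lam φ f)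

/-- The operator norm (w.r.t. ℓ²(β)) of a formal map T. -/
noncomputable def opNorm {V : Type*} (β : V → ℝ) (T : (V → ℂ) → (V → ℂ)) : ℝ :=
  sInf {C : ℝ | 0 ≤ C ∧ ∀ f : V → ℂ, MemL2 β f →
    wnormSq β (T f) ≤ C ^ 2 * wnormSq β f}

/-- Cauchy product of symbols. -/
def cauchyMul (φ ψ : ℕ → ℂ) : ℕ → ℂ :=
  fun k => ∑ j ∈ Finset.range (k + 1), φ j * ψ (k - j)

/-- The spectral radius of the weighted shift, via the Gelfand formula. -/
noncomputable def specRad {V : Type*} [DecidableEq V] (root : V) (par : V → V)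
    (β lam : V → ℝ) : ℝ :=
  ⨅ n : ℕ, (opNorm β (fun f => (shiftMapR root par lam)^[n + 1] f)) ^ ((1 : ℝ) / ((n : ℝ) + 1))

/-- The explicit formula for the adjoint S_λ^* of the weighted shift. -/
noncomputable def SStar {V : Type*} [DecidableEq V] (root : V) (par : V → V)
    (β lam : V → ℝ) (g : V → ℂ) : V → ℂ :=
  fun u => ∑' v : {v : V // v ≠ root ∧ par v = u}, ((lam v.1 * (β v.1 / β u) : ℝ) : ℂ) * g v.1

/-- p : ℕ → V enumerates a path of the directed tree. -/
def IsPath {V : Type*} (root : V) (par : V → V) (p : ℕ → V) : Prop :=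
  p 0 = root ∧ ∀ k, par (p (k + 1)) = p k ∧ p (k + 1) ≠ root

/-- r₂^P(S_λ) for a path p. -/
noncomputable def r2P {V : Type*} (β lam : V → ℝ) (p : ℕ → V) : ℝ :=
  Filter.liminf
    (fun k : ℕ => (Real.sqrt (β (p k)) * ∏ j ∈ Finset.range k, lam (p (j + 1))) ^ ((1 : ℝ) / (k : ℝ)))
    Filter.atTop

/-- r₂⁺(S_λ) : the supremum of r₂^P(S_λ) over all paths. -/
noncomputable def r2plus {V : Type*} (root : V) (par : V → V) (β lam : V → ℝ) : ℝ :=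
  sSup {r : ℝ | ∃ p : ℕ → V, IsPath root par p ∧ r = r2P β lam p}

open scoped Polynomial in
/-- Multiplication by a polynomial bounded by `M` on the unit circle scales the `ℓ²` norm of the
coefficients by at most `M`. -/
theorem sum_sq_norm_coeff_mul_le (p q : ℂ[X]) {M : ℝ}
    (hp : ∀ z : ℂ, ‖z‖ = 1 → ‖p.eval z‖ ≤ M) {m : ℕ} (hq : q.natDegree < m) (n : ℕ) :
    ∑ i ∈ Finset.range n, ‖(p * q).coeff i‖ ^ 2
      ≤ M ^ 2 * ∑ i ∈ Finset.range m, ‖q.coeff i‖ ^ 2 := by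
  have hint : ∀ r : ℂ[X], CircleIntegrable (fun z => ‖r.eval z‖ ^ 2) 0 1 := fun r =>
    ContinuousOn.circleIntegrable zero_le_one
      (Continuous.continuousOn (by fun_prop))
  calc ∑ i ∈ Finset.range n, ‖(p * q).coeff i‖ ^ 2
      ≤ ∑ i ∈ (p * q).support, ‖(p * q).coeff i‖ ^ 2 := by
        rw [← Finset.sum_filter_ne_zero]
        refine Finset.sum_le_sum_of_subset_of_nonneg (fun i hi => ?_) fun _ _ _ => sq_nonneg _
        have := (Finset.mem_filter.1 hi).2
        rw [Polynomial.mem_support_iff]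
        intro h
        simp [h] at this
    _ = Real.circleAverage (fun z => ‖(p * q).eval z‖ ^ 2) 0 1 :=
        Polynomial.sum_sq_norm_coeff_eq_circleAverage _
    _ ≤ Real.circleAverage (fun z => M ^ 2 • ‖q.eval z‖ ^ 2) 0 1 := by
        refine Real.circleAverage_mono (hint _) ((hint q).const_smul) fun z hz => ?_
        have hz1 : ‖z‖ = 1 := by simpa using hz
        rw [Polynomial.eval_mul, norm_mul, mul_pow, smul_eq_mul]
        gcongr
        exact hp z hz1
    _ = M ^ 2 * ∑ i ∈ q.support, ‖q.coeff i‖ ^ 2 := by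
        rw [Real.circleAverage_fun_smul, smul_eq_mul,
          Polynomial.sum_sq_norm_coeff_eq_circleAverage]
    _ ≤ M ^ 2 * ∑ i ∈ Finset.range m, ‖q.coeff i‖ ^ 2 := by
        gcongr
        intro i hi
        exact Finset.mem_range.2
          ((Polynomial.le_natDegree_of_mem_supp i hi).trans_lt hq)

open scoped Polynomial in
/-- A polynomial in the backward shift, acting on a finitely supported sequence. -/
theorem sum_sq_norm_backwardShift_le (p : ℂ[X]) {M : ℝ}
    (hp : ∀ z : ℂ, ‖z‖ = 1 → ‖p.eval z‖ ≤ M) (x : ℕ → ℂ) (K : ℕ) (hx : ∀ k, K < k → x k = 0) :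
    ∑ k ∈ Finset.range (K + 1), ‖∑ j ∈ Finset.range (p.natDegree + 1), p.coeff j * x (k + j)‖ ^ 2
      ≤ M ^ 2 * ∑ k ∈ Finset.range (K + 1), ‖x k‖ ^ 2 := by
  set q : ℂ[X] := ∑ m ∈ Finset.range (K + 1), Polynomial.monomial m (x (K - m)) with hq
  have hcoeff : ∀ i, q.coeff i = if i ≤ K then x (K - i) else 0 := by
    intro i
    simp [hq, Polynomial.finsetSum_coeff, Polynomial.coeff_monomial]
  have hdeg : q.natDegree < K + 1 := by
    refine Nat.lt_succ_of_le (Polynomial.natDegree_le_iff_coeff_eq_zero.2 fun i hi => ?_)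
    rw [hcoeff, if_neg (by omega)]
  have key := sum_sq_norm_coeff_mul_le p q hp hdeg (K + 1)
  rw [← Finset.sum_range_reflect (fun i => ‖(p * q).coeff i‖ ^ 2),
    ← Finset.sum_range_reflect (fun i => ‖q.coeff i‖ ^ 2)] at key
  have hl : ∑ k ∈ Finset.range (K + 1),
        ‖∑ j ∈ Finset.range (p.natDegree + 1), p.coeff j * x (k + j)‖ ^ 2
      = ∑ k ∈ Finset.range (K + 1), ‖(p * q).coeff (K + 1 - 1 - k)‖ ^ 2 := by
    refine Finset.sum_congr rfl fun k hk => ?_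
    have hk' : k ≤ K := Nat.lt_succ_iff.1 (Finset.mem_range.1 hk)
    congr 2
    rw [Polynomial.coeff_mul, Finset.Nat.sum_antidiagonal_eq_sum_range_succ_mk,
      show K + 1 - 1 - k = K - k by omega]
    have hsub : ∀ m, m ≤ p.natDegree + K + 1 →
        (∀ j, m ≤ j → p.coeff j * x (k + j) = 0) →
        ∑ j ∈ Finset.range m, p.coeff j * x (k + j)
          = ∑ j ∈ Finset.range (p.natDegree + K + 1), p.coeff j * x (k + j) := by
      intro m hm h0
      refine Finset.sum_subset (Finset.range_mono hm) fun j _ hj => h0 j ?_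
      simpa using hj
    rw [hsub (p.natDegree + 1) (by omega), ← hsub (K - k).succ (by omega)]
    · refine Finset.sum_congr rfl fun j hj => ?_
      have := Finset.mem_range.1 hj
      simp only []
      rw [hcoeff, if_pos (by omega), show K - (K - k - j) = k + j by omega]
    · intro j hj
      rw [hx _ (by omega), mul_zero]
    · intro j hj
      rw [Polynomial.coeff_eq_zero_of_natDegree_lt (by omega), zero_mul]
  have hr : ∑ k ∈ Finset.range (K + 1), ‖x k‖ ^ 2
      = ∑ k ∈ Finset.range (K + 1), ‖q.coeff (K + 1 - 1 - k)‖ ^ 2 := by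
    refine Finset.sum_congr rfl fun k hk => ?_
    have hk' : k ≤ K := Nat.lt_succ_iff.1 (Finset.mem_range.1 hk)
    rw [hcoeff, if_pos (by omega), show K - (K + 1 - 1 - k) = k by omega]
  rw [hl, hr]
  exact key

/-- The squared weighted `ℓ²` norm with values in `[0, ∞]`. -/
def ewnormSq {V : Type*} (b : V → ℝ≥0∞) (f : V → ℂ) : ℝ≥0∞ :=
  ∑' v, b v * ‖f v‖ₑ ^ 2

theorem ewnormSq_add_ne_top {V : Type*} {b : V → ℝ≥0∞} {f g : V → ℂ}
    (hf : ewnormSq b f ≠ ⊤) (hg : ewnormSq b g ≠ ⊤) : ewnormSq b (f + g) ≠ ⊤ := by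
  have hle : ewnormSq b (f + g) ≤ 2 * (ewnormSq b f + ewnormSq b g) := by
    unfold ewnormSq
    rw [← ENNReal.tsum_add, ← ENNReal.tsum_mul_left]
    refine ENNReal.tsum_le_tsum fun v => ?_
    rw [← mul_add, mul_left_comm]
    gcongr
    calc ‖(f + g) v‖ₑ ^ 2 ≤ (‖f v‖ₑ + ‖g v‖ₑ) ^ 2 := by
          gcongr
          exact enorm_add_le _ _
      _ ≤ 2 * (‖f v‖ₑ ^ 2 + ‖g v‖ₑ ^ 2) := by
          simp only [enorm_eq_nnnorm]
          norm_cast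
          exact add_sq_le
  exact ne_top_of_le_ne_top (by finiteness) hle

theorem ewnormSq_smul {V : Type*} (b : V → ℝ≥0∞) (c : ℂ) (f : V → ℂ) :
    ewnormSq b (c • f) = ‖c‖ₑ ^ 2 * ewnormSq b f := by
  unfold ewnormSq
  rw [← ENNReal.tsum_mul_left]
  refine tsum_congr fun v => ?_
  rw [Pi.smul_apply, smul_eq_mul, enorm_mul, mul_pow]
  ring

theorem ewnormSq_add_weight {V : Type*} (b c : V → ℝ≥0∞) (f : V → ℂ) :
    ewnormSq (b + c) f = ewnormSq b f + ewnormSq c f := by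
  simp [ewnormSq, add_mul, ENNReal.tsum_add]

/-- Fatou's lemma for the weighted `ℓ²` norm. -/
theorem ewnormSq_le_of_tendsto {V ι : Type*} {l : Filter ι} [l.NeBot] {b : V → ℝ≥0∞}
    (hb : ∀ v, b v ≠ ⊤) {F : ι → V → ℂ} {f : V → ℂ} {B : ι → ℝ≥0∞} {C : ℝ≥0∞}
    (hF : ∀ v, Tendsto (fun i => F i v) l (nhds (f v))) (hB : Tendsto B l (nhds C))
    (hle : ∀ᶠ i in l, ewnormSq b (F i) ≤ B i) : ewnormSq b f ≤ C := by
  rw [ewnormSq, ENNReal.tsum_eq_iSup_sum]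
  refine iSup_le fun s => ?_
  refine le_of_tendsto_of_tendsto
    (f := fun i => ∑ v ∈ s, b v * ‖F i v‖ₑ ^ 2) ?_ hB ?_
  · refine tendsto_finsetSum _ fun v _ => ?_
    exact ENNReal.Tendsto.const_mul (ENNReal.Tendsto.pow ((hF v).enorm)) (Or.inr (hb v))
  · filter_upwards [hle] with i hi
    exact (ENNReal.sum_le_tsum s).trans hi

open scoped Polynomial in
/-- **Von Neumann's inequality** for a strict contraction of a weighted `ℓ²` space whose defect
operator is diagonal and whose orbits vanish eventually in each coordinate. -/
theorem ewnormSq_aeval_le {V : Type*} {b c w : V → ℝ≥0∞} {θ : ℝ≥0∞}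
    (T : Module.End ℂ (V → ℂ)) (hT : ∀ f, ewnormSq b (T f) = ewnormSq c f)
    (hθ : θ < 1) (hc : ∀ u, c u ≤ θ * b u) (hw : w + c = b)
    (hnil : ∀ f u, ∃ K, ∀ k, K < k → (T ^ k) f u = 0)
    (p : ℂ[X]) {M : ℝ} (hp : ∀ z : ℂ, ‖z‖ = 1 → ‖p.eval z‖ ≤ M)
    {f : V → ℂ} (hf : ewnormSq b f ≠ ⊤) :
    ewnormSq b (Polynomial.aeval T p f) ≤ ENNReal.ofReal (M ^ 2) * ewnormSq b f := by
  have hTle : ∀ f, ewnormSq b (T f) ≤ θ * ewnormSq b f := by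
    intro f
    rw [hT, ewnormSq, ewnormSq, ← ENNReal.tsum_mul_left]
    refine ENNReal.tsum_le_tsum fun u => ?_
    rw [← mul_assoc]
    gcongr
    exact hc u
  have hpow : ∀ f n, ewnormSq b ((T ^ n) f) ≤ θ ^ n * ewnormSq b f := by
    intro f n
    induction n with
    | zero => simp
    | succ n ih =>
      rw [pow_succ', Module.End.mul_apply, pow_succ', mul_assoc]
      exact (hTle _).trans (by gcongr)
  have htel : ∀ f n, ewnormSq b f
      = ∑ k ∈ Finset.range n, ewnormSq w ((T ^ k) f) + ewnormSq b ((T ^ n) f) := by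
    intro f n
    induction n with
    | zero => simp
    | succ n ih =>
      rw [Finset.sum_range_succ, pow_succ', Module.End.mul_apply, hT, add_assoc,
        ← ewnormSq_add_weight, hw]
      exact ih
  set g := Polynomial.aeval T p f with hg
  have hgfin : ewnormSq b g ≠ ⊤ := by
    rw [hg, Polynomial.aeval_eq_sum_range, LinearMap.sum_apply]
    refine Finset.sum_induction _ (fun h => ewnormSq b h ≠ ⊤)
      (fun _ _ => ewnormSq_add_ne_top) (by simp [ewnormSq]) fun j _ => ?_
    rw [LinearMap.smul_apply, ewnormSq_smul]
    have hθt : θ ≠ ⊤ := (hθ.trans ENNReal.one_lt_top).ne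
    have : ewnormSq b ((T ^ j) f) ≠ ⊤ := ne_top_of_le_ne_top (by finiteness) (hpow f j)
    finiteness
  have hglim : ewnormSq b g ≤ ∑' k, ewnormSq w ((T ^ k) g) := by
    have h0 : Tendsto (fun n => ∑' k, ewnormSq w ((T ^ k) g) + θ ^ n * ewnormSq b g) atTop
        (nhds (∑' k, ewnormSq w ((T ^ k) g) + 0 * ewnormSq b g)) :=
      tendsto_const_nhds.add
        (ENNReal.Tendsto.mul_const (ENNReal.tendsto_pow_atTop_nhds_zero_of_lt_one hθ)
          (Or.inr hgfin))
    rw [zero_mul, add_zero] at h0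
    refine ge_of_tendsto' h0 fun n => ?_
    calc ewnormSq b g = _ := htel g n
      _ ≤ _ := add_le_add (ENNReal.sum_le_tsum _) (hpow g n)
  have hflim : ∑' k, ewnormSq w ((T ^ k) f) ≤ ewnormSq b f := by
    refine ENNReal.tsum_le_of_sum_range_le fun n => ?_
    rw [htel f n]
    exact le_self_add
  have hTg : ∀ k u, (T ^ k) g u
      = ∑ j ∈ Finset.range (p.natDegree + 1), p.coeff j * (T ^ (k + j)) f u := by
    intro k u
    rw [hg, Polynomial.aeval_eq_sum_range, LinearMap.sum_apply, map_sum, Finset.sum_apply]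
    refine Finset.sum_congr rfl fun j _ => ?_
    rw [LinearMap.smul_apply, map_smul, pow_add, Module.End.mul_apply, Pi.smul_apply, smul_eq_mul]
  have hcoord : ∀ u, ∑' k, ‖(T ^ k) g u‖ₑ ^ 2
      ≤ ENNReal.ofReal (M ^ 2) * ∑' k, ‖(T ^ k) f u‖ₑ ^ 2 := by
    intro u
    obtain ⟨K, hK⟩ := hnil f u
    have hsum : ∀ h : V → ℂ, (∀ k, K < k → (T ^ k) h u = 0) → ∑' k, ‖(T ^ k) h u‖ₑ ^ 2
        = ENNReal.ofReal (∑ k ∈ Finset.range (K + 1), ‖(T ^ k) h u‖ ^ 2) := by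
      intro h hh
      rw [tsum_eq_sum (s := Finset.range (K + 1)),
        ENNReal.ofReal_sum_of_nonneg fun _ _ => sq_nonneg _]
      · refine Finset.sum_congr rfl fun k _ => ?_
        rw [ENNReal.ofReal_pow (norm_nonneg _), ofReal_norm]
      · intro k hk
        rw [hh k (by simpa using hk)]
        simp
    rw [hsum f hK, hsum g, ← ENNReal.ofReal_mul (sq_nonneg _)]
    · refine ENNReal.ofReal_le_ofReal ?_
      simp only [hTg]
      exact sum_sq_norm_backwardShift_le p hp (fun k => (T ^ k) f u) K hK
    · intro k hk
      rw [hTg]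
      exact Finset.sum_eq_zero fun j _ => by rw [hK _ (by omega), mul_zero]
  calc ewnormSq b g ≤ ∑' k, ewnormSq w ((T ^ k) g) := hglim
    _ = ∑' u, w u * ∑' k, ‖(T ^ k) g u‖ₑ ^ 2 := by
        simp only [ewnormSq, ← ENNReal.tsum_mul_left]
        rw [ENNReal.tsum_comm]
    _ ≤ ∑' u, w u * (ENNReal.ofReal (M ^ 2) * ∑' k, ‖(T ^ k) f u‖ₑ ^ 2) := by
        refine ENNReal.tsum_le_tsum fun u => ?_
        gcongr
        exact hcoord u
    _ = ENNReal.ofReal (M ^ 2) * ∑' k, ewnormSq w ((T ^ k) f) := by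
        simp only [ewnormSq]
        rw [ENNReal.tsum_comm, ← ENNReal.tsum_mul_left]
        refine tsum_congr fun u => ?_
        rw [ENNReal.tsum_mul_left]
        ring
    _ ≤ ENNReal.ofReal (M ^ 2) * ewnormSq b f := by gcongr

/-- The weighted shift as a linear endomorphism of the space of all functions on the tree. -/
def shiftEnd {V : Type*} [DecidableEq V] (root : V) (par : V → V) (lam : V → ℝ) :
    Module.End ℂ (V → ℂ) where
  toFun := shiftMapR root par lam
  map_add' f g := by
    ext v
    simp only [shiftMapR, Pi.add_apply]
    split_ifs <;> ring
  map_smul' c f := by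
    ext v
    simp only [shiftMapR, Pi.smul_apply, smul_eq_mul, RingHom.id_apply]
    split_ifs <;> ring

theorem shiftEnd_pow_apply {V : Type*} [DecidableEq V] {root : V} {par : V → V} {depth : V → ℕ}
    (hdepth0 : depth root = 0) (hdepth : ∀ v, v ≠ root → depth v = depth (par v) + 1)
    (lam : V → ℝ) (f : V → ℂ) (k : ℕ) (v : V) :
    (shiftEnd root par lam ^ k) f v
      = if k ≤ depth v then (lamProd par lam k v : ℂ) * f (par^[k] v) else 0 := by
  induction k generalizing v with
  | zero => simp [lamProd]
  | succ k ih =>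
    rw [pow_succ', Module.End.mul_apply]
    change shiftMapR root par lam ((shiftEnd root par lam ^ k) f) v = _
    by_cases hv : v = root
    · simp [shiftMapR, hv, hdepth0]
    · simp only [shiftMapR, hv, if_false, ih, hdepth v hv, Nat.succ_le_succ_iff, lamProd,
        Finset.prod_range_succ', Function.iterate_succ_apply, Function.iterate_zero_apply]
      split_ifs
      · push_cast
        ring
      · simp

open scoped Polynomial in
theorem aeval_shiftEnd_apply {V : Type*} [DecidableEq V] {root : V} {par : V → V} {depth : V → ℕ}
    (hdepth0 : depth root = 0) (hdepth : ∀ v, v ≠ root → depth v = depth (par v) + 1)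
    (lam : V → ℝ) (f : V → ℂ) (p : ℂ[X]) (v : V) :
    Polynomial.aeval (shiftEnd root par lam) p f v = gammaMap par depth lam p.coeff f v := by
  rw [Polynomial.aeval_eq_sum_range' (n := p.natDegree + depth v + 1) (by omega),
    LinearMap.sum_apply, Finset.sum_apply, gammaMap]
  symm
  refine Finset.sum_subset_zero_on_sdiff (Finset.range_mono (by omega)) (fun k hk => ?_)
    fun k hk => ?_
  · have : depth v < k := by simpa using (Finset.mem_sdiff.1 hk).2
    rw [LinearMap.smul_apply, Pi.smul_apply, shiftEnd_pow_apply hdepth0 hdepth,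
      if_neg (by omega), smul_zero]
  · have := Finset.mem_range.1 hk
    rw [LinearMap.smul_apply, Pi.smul_apply, shiftEnd_pow_apply hdepth0 hdepth,
      if_pos (by omega), smul_eq_mul]
    ring

/-- The diagonal weight of `S* S` for the weighted shift `S`. -/
def childWeight {V : Type*} (root : V) (par : V → V) (lam : V → ℝ) (b : V → ℝ≥0∞) (u : V) :
    ℝ≥0∞ :=
  open Classical in
  ∑' v, if v ≠ root ∧ par v = u then b v * ‖(lam v : ℂ)‖ₑ ^ 2 else 0

theorem ewnormSq_shiftMapR {V : Type*} [DecidableEq V] (root : V) (par : V → V) (lam : V → ℝ)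
    (b : V → ℝ≥0∞) (f : V → ℂ) :
    ewnormSq b (shiftMapR root par lam f) = ewnormSq (childWeight root par lam b) f := by
  simp only [ewnormSq, childWeight, ← ENNReal.tsum_mul_right]
  rw [ENNReal.tsum_comm]
  refine tsum_congr fun v => ?_
  rw [tsum_eq_single (par v) fun u hu => by simp [Ne.symm hu]]
  by_cases hv : v = root
  · simp [shiftMapR, hv]
  · simp [shiftMapR, hv, enorm_mul, mul_pow, mul_assoc]

theorem ewnormSq_eVec {V : Type*} [DecidableEq V] (b : V → ℝ≥0∞) (u : V) :
    ewnormSq b (eVec u) = b u := by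
  rw [ewnormSq, tsum_eq_single u fun v hv => by simp [eVec, hv]]
  simp [eVec]

theorem childWeight_const_mul {V : Type*} (root : V) (par : V → V) (lam : V → ℝ)
    (b : V → ℝ≥0∞) (κ : ℝ) (u : V) :
    childWeight root par (fun v => κ * lam v) b u
      = ENNReal.ofReal (κ ^ 2) * childWeight root par lam b u := by
  simp only [childWeight, ← ENNReal.tsum_mul_left]
  refine tsum_congr fun v => ?_
  split_ifs
  · rw [Complex.ofReal_mul, enorm_mul, mul_pow, ← sq_abs κ, ENNReal.ofReal_pow (abs_nonneg κ),
      ← Real.norm_eq_abs, ofReal_norm,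
      ← enorm_norm (κ : ℂ), Complex.norm_real, enorm_norm]
    ring
  · simp

/-- Power series version of von Neumann's inequality for a weighted shift of norm less than `1`. -/
theorem ewnormSq_gammaMap_le {V : Type*} [DecidableEq V] {root : V} {par : V → V} {depth : V → ℕ}
    (hdepth0 : depth root = 0) (hdepth : ∀ v, v ≠ root → depth v = depth (par v) + 1)
    {b : V → ℝ≥0∞} (hb : ∀ v, b v ≠ ⊤) {lam : V → ℝ} {θ : ℝ≥0∞} (hθ : θ < 1)
    (hc : ∀ u, childWeight root par lam b u ≤ θ * b u)
    {a : ℕ → ℂ} (ha : Summable fun k => ‖a k‖) {M : ℝ}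
    (hM : ∀ z : ℂ, ‖z‖ = 1 → ‖∑' k, a k * z ^ k‖ ≤ M)
    {f : V → ℂ} (hf : ewnormSq b f ≠ ⊤) :
    ewnormSq b (gammaMap par depth lam a f) ≤ ENNReal.ofReal (M ^ 2) * ewnormSq b f := by
  set T := shiftEnd root par lam with hTdef
  have htail : Tendsto (fun n => M + ∑' k, ‖a (k + n)‖) atTop (nhds M) := by
    simpa using tendsto_const_nhds.add (tendsto_sum_nat_add fun k => ‖a k‖)
  refine ewnormSq_le_of_tendsto (l := atTop) hb
    (F := fun n => Polynomial.aeval T (PowerSeries.trunc n (PowerSeries.mk a)) f)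
    (B := fun n => ENNReal.ofReal ((M + ∑' k, ‖a (k + n)‖) ^ 2) * ewnormSq b f) ?_ ?_ ?_
  · intro v
    refine tendsto_const_nhds.congr' ?_
    filter_upwards [eventually_gt_atTop (depth v)] with n hn
    rw [aeval_shiftEnd_apply hdepth0 hdepth, gammaMap, gammaMap]
    refine Finset.sum_congr rfl fun k hk => ?_
    have := Finset.mem_range.1 hk
    rw [PowerSeries.coeff_trunc, if_pos (by omega), PowerSeries.coeff_mk]
  · exact ENNReal.Tendsto.mul_const (ENNReal.tendsto_ofReal (htail.pow 2)) (Or.inr hf)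
  · refine Eventually.of_forall fun n => ?_
    refine ewnormSq_aeval_le (w := fun u => b u - childWeight root par lam b u) T
      (fun f => ewnormSq_shiftMapR root par lam b f) hθ hc ?_ ?_ _ ?_ hf
    · ext u
      exact tsub_add_cancel_of_le ((hc u).trans (mul_le_of_le_one_left' hθ.le))
    · intro f u
      refine ⟨depth u, fun k hk => ?_⟩
      rw [hTdef, shiftEnd_pow_apply hdepth0 hdepth, if_neg (by omega)]
    · intro z hz
      have hn : Summable fun k => ‖a k * z ^ k‖ := by simpa [hz] using ha
      have hs := hn.of_norm.sum_add_tsum_nat_add n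
      have hev : (PowerSeries.trunc n (PowerSeries.mk a)).eval z
          = ∑ k ∈ Finset.range n, a k * z ^ k := by
        rw [← Polynomial.eval₂_id, PowerSeries.eval₂_trunc_eq_sum_range]
        simp
      rw [hev, eq_sub_of_add_eq hs]
      refine (norm_sub_le _ _).trans (add_le_add (hM z hz) ?_)
      have hn' : Summable fun k => ‖a (k + n) * z ^ (k + n)‖ := hn.comp_injective
        (add_left_injective n)
      refine (norm_tsum_le_tsum_norm hn').trans (le_of_eq ?_)
      simp only [norm_mul, norm_pow, hz, one_pow, mul_one]

theorem memL2_iff {V : Type*} {β : V → ℝ} (hβ : ∀ v, 0 ≤ β v) (f : V → ℂ) :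
    MemL2 β f ↔ ewnormSq (fun v => ENNReal.ofReal (β v)) f ≠ ⊤ := by
  have h : ∀ v, ENNReal.ofReal (β v) * ‖f v‖ₑ ^ 2 = ENNReal.ofReal (β v * ‖f v‖ ^ 2) := by
    intro v
    rw [ENNReal.ofReal_mul (hβ v), ENNReal.ofReal_pow (norm_nonneg _), ofReal_norm]
  simp only [MemL2, ewnormSq, h]
  refine ⟨fun hs => hs.tsum_ofReal_ne_top, fun ht => ?_⟩
  refine (ENNReal.summable_toReal ht).congr fun v => ?_
  rw [ENNReal.toReal_ofReal (by have := hβ v; positivity)]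

theorem ewnormSq_eq_ofReal {V : Type*} {β : V → ℝ} (hβ : ∀ v, 0 ≤ β v) {f : V → ℂ}
    (hf : MemL2 β f) :
    ewnormSq (fun v => ENNReal.ofReal (β v)) f = ENNReal.ofReal (wnormSq β f) := by
  rw [wnormSq, ENNReal.ofReal_tsum_of_nonneg (fun v => by have := hβ v; positivity) hf]
  refine tsum_congr fun v => ?_
  rw [ENNReal.ofReal_mul (hβ v), ENNReal.ofReal_pow (norm_nonneg _), ofReal_norm]

theorem wnormSq_nonneg {V : Type*} {β : V → ℝ} (hβ : ∀ v, 0 ≤ β v) (f : V → ℂ) :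
    0 ≤ wnormSq β f :=
  tsum_nonneg fun v => mul_nonneg (hβ v) (sq_nonneg _)

theorem opNorm_nonneg {V : Type*} (β : V → ℝ) (T : (V → ℂ) → V → ℂ) : 0 ≤ opNorm β T :=
  Real.sInf_nonneg fun _ hC => hC.1

/-- The infimum defining the operator norm of a bounded map is attained. -/
theorem wnormSq_le_opNorm {V : Type*} {β : V → ℝ} (hβ : ∀ v, 0 ≤ β v) {T : (V → ℂ) → V → ℂ}
    {C : ℝ} (hC : ∀ f, MemL2 β f → wnormSq β (T f) ≤ C * wnormSq β f)
    {f : V → ℂ} (hf : MemL2 β f) : wnormSq β (T f) ≤ opNorm β T ^ 2 * wnormSq β f := by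
  set s := {C : ℝ | 0 ≤ C ∧ ∀ f : V → ℂ, MemL2 β f → wnormSq β (T f) ≤ C ^ 2 * wnormSq β f}
    with hs
  have hne : s.Nonempty := by
    refine ⟨√(max C 0), Real.sqrt_nonneg _, fun f hf => (hC f hf).trans ?_⟩
    rw [Real.sq_sqrt (le_max_right _ _)]
    exact mul_le_mul_of_nonneg_right (le_max_left _ _) (wnormSq_nonneg hβ f)
  have hclosed : IsClosed s := by
    rw [hs, Set.ofPred_and]
    refine isClosed_Ici.inter ?_
    simp only [Set.ofPred_forall]
    exact isClosed_iInter fun f => isClosed_iInter fun _ =>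
      isClosed_le continuous_const (by fun_prop)
  exact (hclosed.csInf_mem hne ⟨0, fun _ h => h.1⟩).2 f hf

/-- The defect bound coming from boundedness of the weighted shift. -/
theorem childWeight_le_opNorm {V : Type*} [DecidableEq V] {root : V} {par : V → V}
    {β lam : V → ℝ} (hβ : ∀ v, 0 ≤ β v)
    (hbdd : ∃ C : ℝ, ∀ f : V → ℂ, MemL2 β f → MemL2 β (shiftMapR root par lam f) ∧
      wnormSq β (shiftMapR root par lam f) ≤ C * wnormSq β f) (u : V) :
    childWeight root par lam (fun v => ENNReal.ofReal (β v)) u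
      ≤ ENNReal.ofReal (opNorm β (shiftMapR root par lam) ^ 2) * ENNReal.ofReal (β u) := by
  obtain ⟨C, hC⟩ := hbdd
  set b : V → ℝ≥0∞ := fun v => ENNReal.ofReal (β v) with hb
  have hu : MemL2 β (eVec u) := by
    rw [memL2_iff hβ, ewnormSq_eVec]
    exact ENNReal.ofReal_ne_top
  rw [← ewnormSq_eVec (childWeight root par lam b), ← ewnormSq_shiftMapR,
    ewnormSq_eq_ofReal hβ (hC _ hu).1, show ENNReal.ofReal (β u) = b u from rfl,
    ← ewnormSq_eVec b u, ewnormSq_eq_ofReal hβ hu, ← ENNReal.ofReal_mul (sq_nonneg _)]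
  exact ENNReal.ofReal_le_ofReal (wnormSq_le_opNorm hβ (fun f hf => (hC f hf).2) hu)

theorem gammaMap_const_mul_weight {V : Type*} (par : V → V) (depth : V → ℕ) (lam : V → ℝ)
    (κ : ℝ) (φ : ℕ → ℂ) (f : V → ℂ) :
    gammaMap par depth (fun v => κ * lam v) φ f
      = gammaMap par depth lam (fun k => (κ : ℂ) ^ k * φ k) f := by
  ext v
  refine Finset.sum_congr rfl fun k _ => ?_
  simp only [lamProd, Finset.prod_mul_distrib, Finset.prod_const, Finset.card_range]
  push_cast
  ring

/-- if the power series of φ converges on the disc of radius ‖S_λ‖ and φ is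
bounded there, then φ̂ ∈ M(T_β,λ) and ‖M_φ̂‖ ≤ sup{|φ(z)| : |z| < ‖S_λ‖}. -/
theorem stmt9 {V : Type*} [Countable V] [Infinite V] [DecidableEq V]
    (root : V) (par : V → V) (depth : V → ℕ)
    (hdepth0 : depth root = 0)
    (hdepth : ∀ v, v ≠ root → depth v = depth (par v) + 1)
    (hreach : ∀ v, par^[depth v] v = root)
    (hleafless : ∀ u : V, ∃ v : V, v ≠ root ∧ par v = u)
    (β : V → ℝ) (hβ : ∀ v, 0 < β v)
    (lam : V → ℝ) (hlam : ∀ v, v ≠ root → 0 < lam v)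
    (hbdd : ∃ C : ℝ, ∀ f : V → ℂ, MemL2 β f →
        MemL2 β (shiftMapR root par lam f) ∧
        wnormSq β (shiftMapR root par lam f) ≤ C * wnormSq β f)
    (φ : ℕ → ℂ)
    (hconv : ∀ z : ℂ, ‖z‖ < opNorm β (shiftMapR root par lam) →
        Summable fun k : ℕ => φ k * z ^ k)
    (hbound : ∃ B : ℝ, ∀ z : ℂ, ‖z‖ < opNorm β (shiftMapR root par lam) →
        ‖∑' k : ℕ, φ k * z ^ k‖ ≤ B) :
    Mult par depth β lam φ ∧
    opNorm β (gammaMap par depth lam φ)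
      ≤ sSup {x : ℝ | ∃ z : ℂ, ‖z‖ < opNorm β (shiftMapR root par lam)
          ∧ x = ‖∑' k : ℕ, φ k * z ^ k‖} := by
  have hβ0 : ∀ v, 0 ≤ β v := fun v => (hβ v).le
  set r := opNorm β (shiftMapR root par lam) with hr
  set b : V → ℝ≥0∞ := fun v => ENNReal.ofReal (β v) with hb
  have hcw := childWeight_le_opNorm hβ0 hbdd
  have hr0 : 0 < r := by
    refine lt_of_le_of_ne (opNorm_nonneg _ _) fun h0 => ?_
    obtain ⟨v, hv, hpar⟩ := hleafless root
    have h1 := hcw root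
    rw [← hr, ← h0] at h1
    have h2 : childWeight root par lam b root = 0 := by simpa using h1
    rw [childWeight, ENNReal.tsum_eq_zero] at h2
    simpa [hv, hpar, hb, (hβ v).not_ge, (hlam v hv).ne'] using h2 v
  set S := {x : ℝ | ∃ z : ℂ, ‖z‖ < r ∧ x = ‖∑' k : ℕ, φ k * z ^ k‖} with hS
  have hSle : ∀ z : ℂ, ‖z‖ < r → ‖∑' k : ℕ, φ k * z ^ k‖ ≤ sSup S := by
    intro z hz
    obtain ⟨B, hB⟩ := hbound
    refine le_csSup ⟨B, ?_⟩ ⟨z, hz, rfl⟩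
    rintro _ ⟨w, hw, rfl⟩
    exact hB w hw
  have hS0 : 0 ≤ sSup S := (norm_nonneg _).trans (hSle 0 (by simpa using hr0))
  have key : ∀ f, MemL2 β f →
      ewnormSq b (gammaMap par depth lam φ f) ≤ ENNReal.ofReal (sSup S ^ 2) * ewnormSq b f := by
    intro f hf
    refine ewnormSq_le_of_tendsto (l := nhdsWithin (1 : ℝ) (Set.Iio 1))
      (fun v => ENNReal.ofReal_ne_top)
      (F := fun t => gammaMap par depth (fun v => t / r * lam v)
        (fun k => φ k * ((t * r : ℝ) : ℂ) ^ k) f) ?_ tendsto_const_nhds ?_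
    · intro v
      have hcont : Continuous fun t : ℝ =>
          gammaMap par depth lam (fun k => φ k * ((t : ℂ) ^ k) ^ 2) f v := by
        unfold gammaMap
        fun_prop
      have h1 := (hcont.tendsto 1).mono_left (nhdsWithin_le_nhds (s := Set.Iio 1))
      have hrC : (r : ℂ) ≠ 0 := by exact_mod_cast hr0.ne'
      convert h1 using 2 with t
      · rw [gammaMap_const_mul_weight]
        congr 1
        ext k
        have hk : ((t / r : ℝ) : ℂ) * ((t * r : ℝ) : ℂ) = (t : ℂ) ^ 2 := by
          push_cast
          field_simp
        rw [mul_left_comm, ← mul_pow, hk, ← pow_mul, ← pow_mul, mul_comm 2 k]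
      · simp
    · filter_upwards [self_mem_nhdsWithin,
        mem_nhdsWithin_of_mem_nhds (lt_mem_nhds zero_lt_one)] with t ht1 ht0
      have ht1 : t < 1 := ht1
      have hz : ∀ z : ℂ, ‖z‖ = 1 → ‖((t * r : ℝ) : ℂ) * z‖ < r := by
        intro z hz
        rw [norm_mul, hz, mul_one, Complex.norm_real, Real.norm_of_nonneg (by positivity)]
        exact mul_lt_of_lt_one_left hr0 ht1
      refine ewnormSq_gammaMap_le hdepth0 hdepth (fun v => ENNReal.ofReal_ne_top)
        (θ := ENNReal.ofReal (t ^ 2)) ?_ ?_ ?_ ?_ ((memL2_iff hβ0 f).1 hf)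
      · rw [ENNReal.ofReal_lt_one]
        exact pow_lt_one₀ ht0.le ht1 two_ne_zero
      · intro u
        rw [childWeight_const_mul]
        refine (mul_le_mul_right (hcw u) _).trans (le_of_eq ?_)
        rw [← mul_assoc, ← ENNReal.ofReal_mul (sq_nonneg _), ← hr, ← mul_pow,
          div_mul_cancel₀ _ hr0.ne']
      · simpa using (hconv _ (hz 1 norm_one)).norm
      · intro z hz1
        simpa [mul_pow, mul_assoc] using hSle _ (hz z hz1)
  have hmult : Mult par depth β lam φ := by
    intro f hf
    rw [memL2_iff hβ0]
    exact ne_top_of_le_ne_top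
      (ENNReal.mul_ne_top ENNReal.ofReal_ne_top ((memL2_iff hβ0 f).1 hf)) (key f hf)
  refine ⟨hmult, csInf_le ⟨0, fun _ h => h.1⟩ ⟨hS0, fun f hf => ?_⟩⟩
  have h := key f hf
  rwa [hb, ewnormSq_eq_ofReal hβ0 (hmult f hf), ewnormSq_eq_ofReal hβ0 hf,
    ← ENNReal.ofReal_mul (sq_nonneg _),
    ENNReal.ofReal_le_ofReal_iff (mul_nonneg (sq_nonneg _) (wnormSq_nonneg hβ0 f))] at h
end
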